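/- Fix indices i ≠ j in {1,…,l} and let w ∈ ℝ^I be the vector with coordinates w_{(i)} = √(d_j), w_{(j)} = √(d_i), w_{(ij)} = −2·√(d_i·d_j)/√(m_i·m_j), and all other coordinates zero. Then M·w = ((m−1−2κ)/(m−2))·w, i.e., w is an eigenvector of M with eigenvalue (m−1−2κ)/(m−2). -/

import Mathlib

open Finset

/-- The index set: `l` symbols `(i)` together with the unordered pairs `(ij)`, `i ≠ j`. -/
abbrev WZIndex (l : ℕ) := Fin l ⊕ {s : Finset (Fin l) // s.card = 2}

/-- The matrix of the Lichnerowicz Laplacian of the standard Einstein metric of the spaces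
`SO(m)/K₁×⋯×K_l` (Wang–Ziller's conceptual construction, no Grassmannians or spheres). -/
noncomputable def WZMatrix (l : ℕ) (mm : Fin l → ℝ) (κ : ℝ) :
    Matrix (WZIndex l) (WZIndex l) ℝ :=
  let m : ℝ := ∑ i, mm i
  let d : Fin l → ℝ := fun i => mm i * (mm i - 1) / 2 - κ * mm i
  fun p q =>
    match p, q with
    | Sum.inl i, Sum.inl j => if i = j then (m - mm i) / (m - 2) else 0
    | Sum.inl i, Sum.inr s =>
        if i ∈ s.1 then
          -Real.sqrt (d i * (∑ h ∈ s.1.erase i, mm h) / mm i) / (m - 2)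
        else 0
    | Sum.inr s, Sum.inl i =>
        if i ∈ s.1 then
          -Real.sqrt (d i * (∑ h ∈ s.1.erase i, mm h) / mm i) / (m - 2)
        else 0
    | Sum.inr s, Sum.inr t =>
        if s = t then
          (m - (∑ h ∈ s.1, mm h) + ∑ h ∈ s.1, d h / mm h) / (m - 2)
        else if (s.1 ∩ t.1).card = 1 then
          -Real.sqrt ((∑ h ∈ s.1 \ t.1, mm h) * (∑ h ∈ t.1 \ s.1, mm h)) / (2 * (m - 2))
        else 0



theorem wz_pair {l : ℕ} {S : Finset (Fin l)} (hS : S.card = 2) {i j : Fin l} (hij : i ≠ j)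
    (hi : i ∈ S) (hj : j ∈ S) : S = {i, j} := by
  symm
  apply Finset.eq_of_subset_of_card_le
  · intro a ha
    simp only [Finset.mem_insert, Finset.mem_singleton] at ha
    rcases ha with rfl | rfl <;> assumption
  · rw [hS, Finset.card_pair hij]

theorem wz_other {l : ℕ} {S : Finset (Fin l)} (hS : S.card = 2) {i : Fin l}
    (hi : i ∈ S) : ∃ k, k ≠ i ∧ S = {i, k} := by
  obtain ⟨a, b, hab, rfl⟩ := Finset.card_eq_two.mp hS
  simp only [Finset.mem_insert, Finset.mem_singleton] at hi
  rcases hi with rfl | rfl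
  · exact ⟨b, hab.symm, rfl⟩
  · exact ⟨a, hab, Finset.pair_comm _ _⟩

theorem wz_sqrt {d m n : ℝ} (hd : 0 < d) (hm : 0 < m) (hn : 0 < n) :
    Real.sqrt (d * n / m) = Real.sqrt d * Real.sqrt n / Real.sqrt m := by
  rw [Real.sqrt_div (by positivity), Real.sqrt_mul hd.le]

/-- For fixed `i ≠ j`, the displayed vector `w` is an eigenvector of the
above matrix with eigenvalue `(m-1-2κ)/(m-2)`. -/
theorem stmt16 (l : ℕ) (hl : 2 ≤ l) (mm : Fin l → ℝ) (κ : ℝ)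
    (hmm : ∀ i, 0 < mm i) (hm : 2 < ∑ i, mm i)
    (hd : ∀ i, 0 < mm i * (mm i - 1) / 2 - κ * mm i)
    (i j : Fin l) (hij : i ≠ j)
    (w : WZIndex l → ℝ)
    (hw : w = fun p =>
      match p with
      | Sum.inl a =>
          if a = i then Real.sqrt (mm j * (mm j - 1) / 2 - κ * mm j)
          else if a = j then Real.sqrt (mm i * (mm i - 1) / 2 - κ * mm i)
          else 0
      | Sum.inr s =>
          if i ∈ s.1 ∧ j ∈ s.1 then
            -2 * Real.sqrt ((mm i * (mm i - 1) / 2 - κ * mm i) *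
              (mm j * (mm j - 1) / 2 - κ * mm j)) / Real.sqrt (mm i * mm j)
          else 0) :
    (WZMatrix l mm κ).mulVec w =
      (((∑ i, mm i) - 1 - 2 * κ) / ((∑ i, mm i) - 2)) • w := by
  
  have key : ∀ p, (WZMatrix l mm κ).mulVec w p =
      WZMatrix l mm κ p (Sum.inl i) * Real.sqrt (mm j * (mm j - 1) / 2 - κ * mm j)
      + WZMatrix l mm κ p (Sum.inl j) * Real.sqrt (mm i * (mm i - 1) / 2 - κ * mm i)
      + WZMatrix l mm κ p (Sum.inr ⟨{i, j}, Finset.card_pair hij⟩) *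
        (-2 * Real.sqrt ((mm i * (mm i - 1) / 2 - κ * mm i) *
              (mm j * (mm j - 1) / 2 - κ * mm j)) / Real.sqrt (mm i * mm j)) := by
    intro p
    unfold Matrix.mulVec dotProduct
    rw [Fintype.sum_sum_type]
    congr 1
    · rw [Finset.sum_eq_add_of_mem i j (Finset.mem_univ _) (Finset.mem_univ _) hij]
      · simp [hw, hij.symm]
      · rintro c - ⟨h1, h2⟩
        simp [hw, h1, h2]
    · rw [Finset.sum_eq_single ⟨{i, j}, Finset.card_pair hij⟩]
      · simp [hw]
      · rintro ⟨S, hS⟩ - hne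
        have : ¬ (i ∈ S ∧ j ∈ S) := by
          rintro ⟨h1, h2⟩
          exact hne (Subtype.ext (wz_pair hS hij h1 h2))
        simp only [hw, if_neg this, mul_zero]
      · simp
  have hx : ∀ a, 0 < Real.sqrt (mm a) := fun a => Real.sqrt_pos.mpr (hmm a)
  have hxx : ∀ a, mm a = Real.sqrt (mm a) ^ 2 := fun a => (Real.sq_sqrt (hmm a).le).symm
  have hDD : ∀ a, Real.sqrt (mm a * (mm a - 1) / 2 - κ * mm a) ^ 2 =
      mm a * (mm a - 1) / 2 - κ * mm a := fun a => Real.sq_sqrt (hd a).le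
  have hm2 : (∑ i, mm i) - 2 ≠ 0 := by linarith
  have hi0 := (hx i).ne'
  have hj0 := (hx j).ne'
  have hmi0 := (hmm i).ne'
  have hmj0 := (hmm j).ne'
  have e1 : ({i, j} : Finset (Fin l)).erase i = {j} := by
    ext a; simp only [mem_erase, mem_insert, mem_singleton]; grind
  have e2 : ({i, j} : Finset (Fin l)).erase j = {i} := by
    ext a; simp only [mem_erase, mem_insert, mem_singleton]; grind
  -- algebraic identity for the rows `(i)`
  have row1 : ∀ m x y p q : ℝ, m - 2 ≠ 0 → x ≠ 0 → y ≠ 0 →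
      p ^ 2 = x ^ 2 * (x ^ 2 - 1) / 2 - κ * x ^ 2 →
      (m - x ^ 2) / (m - 2) * q + -(p * y / x) / (m - 2) * (-2 * (p * q) / (x * y))
        = (m - 1 - 2 * κ) / (m - 2) * q := by
    intro m x y p q h h1 h2 h3
    have : -(p * y / x) / (m - 2) * (-2 * (p * q) / (x * y)) = 2 * p ^ 2 * q / x ^ 2 / (m - 2) := by
      field_simp
    rw [this, h3]
    field_simp
    ring
  funext p
  rw [key p, Pi.smul_apply, smul_eq_mul]
  rcases p with a | ⟨S, hS⟩
  · by_cases hai : a = i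
    · subst hai
      simp only [WZMatrix, hw, if_true, if_neg hij, mem_insert, true_or, e1, sum_singleton]
      rw [wz_sqrt (hd a) (hmm a) (hmm j), Real.sqrt_mul (hd a).le, Real.sqrt_mul (hmm a).le,
        ← row1 _ _ _ _ _ hm2 hi0 hj0 (by rw [hDD a, ← hxx]), ← hxx]
      ring
    · by_cases haj : a = j
      · subst haj
        simp only [WZMatrix, hw, if_true, if_neg hij.symm, mem_insert, mem_singleton, or_true, e2,
          sum_singleton]
        rw [wz_sqrt (hd a) (hmm a) (hmm i), Real.sqrt_mul (hd i).le, Real.sqrt_mul (hmm i).le,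
          ← row1 _ _ _ _ _ hm2 hj0 hi0 (by rw [hDD a, ← hxx]), ← hxx]
        ring
      · simp [WZMatrix, hw, hai, haj]
  · have row3 : ∀ i j k : Fin l, ∀ n : ℝ, 
        -(Real.sqrt (mm i * (mm i - 1) / 2 - κ * mm i) * Real.sqrt (mm k) / Real.sqrt (mm i)) / n *
          Real.sqrt (mm j * (mm j - 1) / 2 - κ * mm j) +
        -(Real.sqrt (mm k) * Real.sqrt (mm j)) / (2 * n) *
          (-2 * (Real.sqrt (mm i * (mm i - 1) / 2 - κ * mm i) *
            Real.sqrt (mm j * (mm j - 1) / 2 - κ * mm j)) /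
            (Real.sqrt (mm i) * Real.sqrt (mm j))) = 0 := by
      intro i j k n
      have hi0 := (hx i).ne'
      have hj0 := (hx j).ne'
      field_simp
      ring
    have sets : ∀ i j k : Fin l, i ≠ j → k ≠ i → k ≠ j →
        ({i, k} : Finset (Fin l)).erase i = {k} ∧ ({i, k} : Finset (Fin l)) ∩ {i, j} = {i} ∧
        ({i, k} : Finset (Fin l)) \ {i, j} = {k} ∧ ({i, j} : Finset (Fin l)) \ {i, k} = {j} ∧
        ({i, k} : Finset (Fin l)) ≠ {i, j} ∧ j ∉ ({i, k} : Finset (Fin l)) := by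
      intro i j k h1 h2 h3
      refine ⟨?_, ?_, ?_, ?_, ?_, ?_⟩
      · ext a; simp only [mem_erase, mem_insert, mem_singleton]; grind
      · ext a; simp only [mem_inter, mem_insert, mem_singleton]; grind
      · ext a; simp only [mem_sdiff, mem_insert, mem_singleton]; grind
      · ext a; simp only [mem_sdiff, mem_insert, mem_singleton]; grind
      · intro h
        have : k ∈ ({i, j} : Finset (Fin l)) := h ▸ (by simp)
        simp only [mem_insert, mem_singleton] at this
        grind
      · simp only [mem_insert, mem_singleton]; grind
    by_cases hi : i ∈ S
    · by_cases hj : j ∈ S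
      · obtain rfl := wz_pair hS hij hi hj
        simp only [WZMatrix, hw, if_true, hi, hj, and_self, e1, e2, sum_singleton,
          Finset.sum_pair hij]
        rw [wz_sqrt (hd i) (hmm i) (hmm j), wz_sqrt (hd j) (hmm j) (hmm i),
          Real.sqrt_mul (hd i).le, Real.sqrt_mul (hmm i).le]
        have c1 : (mm i * (mm i - 1) / 2 - κ * mm i) / mm i = (mm i - 1) / 2 - κ := by
          field_simp
        have c2 : (mm j * (mm j - 1) / 2 - κ * mm j) / mm j = (mm j - 1) / 2 - κ := by
          field_simp
        rw [c1, c2]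
        generalize Real.sqrt (mm i * (mm i - 1) / 2 - κ * mm i) = p
        generalize Real.sqrt (mm j * (mm j - 1) / 2 - κ * mm j) = q
        have h1 := hxx i
        have h2 := hxx j
        generalize (∑ i, mm i) = m at *
        generalize Real.sqrt (mm i) = x at *
        generalize Real.sqrt (mm j) = y at *
        rw [h1, h2]
        field_simp
        ring
      · obtain ⟨k, hk, rfl⟩ := wz_other hS hi
        have hkj : k ≠ j := by rintro rfl; simp at hj
        obtain ⟨s1, s2, s3, s4, s5, s6⟩ := sets i j k hij hk hkj
        simp only [WZMatrix, hw, if_true, hi, hj, s1, s2, s3, s4, sum_singleton, and_false,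
          if_false, Subtype.mk.injEq, s5, card_singleton]
        rw [wz_sqrt (hd i) (hmm i) (hmm k), Real.sqrt_mul (hd i).le, Real.sqrt_mul (hmm i).le,
          Real.sqrt_mul (hmm k).le, zero_mul, add_zero, mul_zero]
        exact row3 i j k _
    · by_cases hj : j ∈ S
      · obtain ⟨k, hk, rfl⟩ := wz_other hS hj
        have hki : k ≠ i := by rintro rfl; simp at hi
        obtain ⟨s1, s2, s3, s4, s5, s6⟩ := sets j i k hij.symm hk hki
        rw [Finset.pair_comm j i] at s2 s3 s4 s5
        simp only [WZMatrix, hw, if_true, hi, hj, s1, s2, s3, s4, sum_singleton, false_and,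
          if_false, Subtype.mk.injEq, s5, card_singleton]
        rw [wz_sqrt (hd j) (hmm j) (hmm k), Real.sqrt_mul (hd i).le, Real.sqrt_mul (hmm i).le,
          Real.sqrt_mul (hmm k).le, zero_mul, zero_add, mul_zero, ← row3 j i k ((∑ i, mm i) - 2)]
        ring
      · have h0 : S ∩ {i, j} = ∅ := by
          ext a; simp only [mem_inter, mem_insert, mem_singleton, notMem_empty]; grind
        have hne : S ≠ {i, j} := by
          rintro rfl; simp at hi
        simp [WZMatrix, hw, hi, hj, h0, hne]
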